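/- arXiv:2604.05356 — 3 statements merged into one kernel-verified Lean document; each statement's English description precedes it below -/
import Mathlib

section
/- Let k_F ∈ (0, π), λ ∈ ℂ, and ℓ ≥ 1. Then det[(λ+1) I_ℓ - 2 C(ℓ)] = (2^{ℓ²}/π^ℓ) · det[ ∫_{-1}^{1} x^{j+k} w_λ(x) dx ]_{j,k=0}^{ℓ-1}, where the Hankel weight is w_λ(x) = √(1-x²) · (λ - 1) for cos k_F < x < 1 and w_λ(x) = √(1-x²) · (λ + 1) for -1 < x < cos k_F. -/
/-- The open-chain correlation matrix `C(ℓ)` of the XX chain at Fermi momentum `k_F`: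
`C(ℓ)_{jk} = sin(k_F(j-k))/(π(j-k)) - sin(k_F(j+k))/(π(j+k))` for `1 ≤ j,k ≤ ℓ`,
with the diagonal of the first (Toeplitz) term interpreted as `k_F/π`.
Indices are `Fin ℓ`, so the physical indices are `j+1, k+1`. -/
noncomputable def openC (kF : ℝ) (ℓ : ℕ) : Matrix (Fin ℓ) (Fin ℓ) ℝ :=
  fun j k =>
    (if (j : ℕ) = (k : ℕ) then kF / Real.pi
      else Real.sin (kF * ((j : ℝ) - (k : ℝ))) / (Real.pi * ((j : ℝ) - (k : ℝ))))
    - Real.sin (kF * ((j : ℝ) + (k : ℝ) + 2)) / (Real.pi * ((j : ℝ) + (k : ℝ) + 2))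

open Polynomial Chebyshev in
/-- Congruence of Hankel-type Gram matrices under a triangular change of basis from monomials to a
graded sequence of polynomials. -/
theorem det_integral_polynomial_mul (P : ℕ → ℝ[X]) (hP : ∀ n, (P n).natDegree = n) {a b : ℝ}
    {w : ℝ → ℂ} (hw : IntervalIntegrable w MeasureTheory.volume a b) (ℓ : ℕ) :
    Matrix.det (fun j k : Fin ℓ =>
        ∫ x in a..b, (((P j).eval x * (P k).eval x : ℝ) : ℂ) * w x) =
      (∏ i ∈ Finset.range ℓ, ((P i).leadingCoeff : ℂ)) ^ 2 *
        Matrix.det (fun j k : Fin ℓ => ∫ x in a..b, (x : ℂ) ^ ((j : ℕ) + (k : ℕ)) * w x) := by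
  set A : Matrix (Fin ℓ) (Fin ℓ) ℂ := fun j i => ((P j).coeff i : ℂ) with hA
  set H : Matrix (Fin ℓ) (Fin ℓ) ℂ :=
    fun j k => ∫ x in a..b, (x : ℂ) ^ ((j : ℕ) + (k : ℕ)) * w x with hH
  have hdet : A.det = ∏ i ∈ Finset.range ℓ, ((P i).leadingCoeff : ℂ) := by
    rw [Matrix.det_of_isLowerTriangular, ← Fin.prod_univ_eq_prod_range
      (fun i => ((P i).leadingCoeff : ℂ))]
    · refine Finset.prod_congr rfl fun i _ => ?_
      rw [Polynomial.leadingCoeff, hP]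
    · intro i j hij
      have : (i : ℕ) < j := hij
      simp only [hA]
      rw [Polynomial.coeff_eq_zero_of_natDegree_lt (by rwa [hP]), Complex.ofReal_zero]
  have heval (n : Fin ℓ) (x : ℝ) :
      (((P n).eval x : ℝ) : ℂ) = ∑ i : Fin ℓ, A n i * (x : ℂ) ^ (i : ℕ) := by
    rw [Polynomial.eval_eq_sum_range' (n := ℓ) (by rw [hP]; exact n.2),
      ← Fin.sum_univ_eq_sum_range (fun i => (P n).coeff i * x ^ i)]
    simp [hA]
  have hM : (fun j k : Fin ℓ => ∫ x in a..b, (((P j).eval x * (P k).eval x : ℝ) : ℂ) * w x) =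
      A * H * A.transpose := by
    ext j k
    have hint (p q : Fin ℓ) : IntervalIntegrable
        (fun x : ℝ => A k q * (A j p * ((x : ℂ) ^ ((p : ℕ) + (q : ℕ)) * w x)))
        MeasureTheory.volume a b :=
      ((hw.continuousOn_mul (by fun_prop)).const_mul _).const_mul _
    calc _ = ∫ x in a..b, ∑ q : Fin ℓ, ∑ p : Fin ℓ,
          A k q * (A j p * ((x : ℂ) ^ ((p : ℕ) + (q : ℕ)) * w x)) := by
          congr 1
          ext x
          rw [Complex.ofReal_mul, heval, heval, Finset.sum_mul_sum, Finset.sum_comm,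
            Finset.sum_mul]
          refine Finset.sum_congr rfl fun q _ => ?_
          rw [Finset.sum_mul]
          refine Finset.sum_congr rfl fun p _ => ?_
          ring
      _ = ∑ q : Fin ℓ, ∑ p : Fin ℓ, A k q * (A j p * H p q) := by
          rw [intervalIntegral.integral_finsetSum fun q _ => by
            simpa only [Finset.sum_fn] using
              (IntervalIntegrable.sum Finset.univ fun p _ => hint p q)]
          refine Finset.sum_congr rfl fun q _ => ?_
          rw [intervalIntegral.integral_finsetSum fun p _ => hint p q]
          simp only [intervalIntegral.integral_const_mul, hH]
      _ = _ := by
          rw [Matrix.mul_apply]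
          refine Finset.sum_congr rfl fun q _ => ?_
          rw [Matrix.mul_apply, Matrix.transpose_apply, Finset.sum_mul]
          refine Finset.sum_congr rfl fun p _ => ?_
          ring
  rw [hM, Matrix.det_mul, Matrix.det_mul, Matrix.det_transpose, hdet]
  ring

theorem intervalIntegrable_step (c a b : ℝ) (u v : ℂ) :
    IntervalIntegrable (fun x : ℝ => if c < x then u else v) MeasureTheory.volume a b := by
  have hm : Measurable fun x : ℝ => if c < x then u else v :=
    Measurable.ite measurableSet_Ioi measurable_const measurable_const
  refine (intervalIntegrable_const (c := ‖u‖ + ‖v‖)).mono_fun hm.aestronglyMeasurable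
    (Filter.Eventually.of_forall fun x => ?_)
  rw [Real.norm_of_nonneg (by positivity)]
  dsimp only
  split_ifs <;> simp

theorem integral_mul_step {g : ℝ → ℂ} (hg : Continuous g) {a b c : ℝ} (hac : a ≤ c) (hcb : c ≤ b)
    (u v : ℂ) :
    ∫ x in a..b, g x * (if c < x then u else v) =
      v * (∫ x in a..b, g x) + (u - v) * ∫ x in c..b, g x := by
  have hi (s t : ℝ) : IntervalIntegrable (fun x => g x * (if c < x then u else v))
      MeasureTheory.volume s t := (intervalIntegrable_step c s t u v).continuousOn_mul hg.continuousOn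
  have hl : ∫ x in a..c, g x * (if c < x then u else v) = ∫ x in a..c, v * g x := by
    refine intervalIntegral.integral_congr_ae (Filter.Eventually.of_forall fun x hx => ?_)
    rw [Set.uIoc_of_le hac] at hx
    rw [if_neg hx.2.not_gt, mul_comm]
  have hr : ∫ x in c..b, g x * (if c < x then u else v) = ∫ x in c..b, u * g x := by
    refine intervalIntegral.integral_congr_ae (Filter.Eventually.of_forall fun x hx => ?_)
    rw [Set.uIoc_of_le hcb] at hx
    rw [if_pos hx.1, mul_comm]
  rw [← intervalIntegral.integral_add_adjacent_intervals (hi a c) (hi c b), hl, hr,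
    ← intervalIntegral.integral_add_adjacent_intervals (hg.intervalIntegrable a c)
      (hg.intervalIntegrable c b),
    intervalIntegral.integral_const_mul, intervalIntegral.integral_const_mul]
  ring

theorem hasDerivAt_openC (ℓ : ℕ) (j k : Fin ℓ) (t : ℝ) :
    HasDerivAt (fun s => openC s ℓ j k)
      (2 / Real.pi * (Real.sin (((j : ℝ) + 1) * t) * Real.sin (((k : ℝ) + 1) * t))) t := by
  have hsin {m : ℝ} (hm : m ≠ 0) :
      HasDerivAt (fun s => Real.sin (s * m) / (Real.pi * m)) (Real.cos (t * m) / Real.pi) t := by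
    refine (((hasDerivAt_id' t).mul_const m).sin.div_const (Real.pi * m)).congr_deriv ?_
    rw [one_mul, mul_div_mul_right _ _ hm]
  have hcos : 2 * (Real.sin (((j : ℝ) + 1) * t) * Real.sin (((k : ℝ) + 1) * t)) =
      Real.cos (t * ((j : ℝ) - k)) - Real.cos (t * ((j : ℝ) + k + 2)) := by
    rw [show t * ((j : ℝ) - k) = ((j : ℝ) + 1) * t - ((k : ℝ) + 1) * t by ring,
      show t * ((j : ℝ) + k + 2) = ((j : ℝ) + 1) * t + ((k : ℝ) + 1) * t by ring,
      Real.cos_sub, Real.cos_add]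
    ring
  rw [div_mul_eq_mul_div, hcos, sub_div]
  refine HasDerivAt.sub ?_ (hsin (by positivity))
  by_cases h : (j : ℕ) = k
  · simpa [h] using (hasDerivAt_id t).div_const Real.pi
  · simpa only [if_neg h] using hsin (sub_ne_zero.mpr (by exact_mod_cast h))

theorem openC_zero (ℓ : ℕ) (j k : Fin ℓ) : openC 0 ℓ j k = 0 := by
  simp [openC]

theorem openC_pi (ℓ : ℕ) (j k : Fin ℓ) : openC Real.pi ℓ j k = if j = k then 1 else 0 := by
  have h1 : Real.sin (Real.pi * ((j : ℝ) - k)) = 0 := by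
    rw [mul_comm]
    exact_mod_cast Real.sin_int_mul_pi ((j : ℤ) - k)
  have h2 : Real.sin (Real.pi * ((j : ℝ) + k + 2)) = 0 := by
    rw [mul_comm]
    exact_mod_cast Real.sin_nat_mul_pi ((j : ℕ) + k + 2)
  simp [openC, h1, h2, Fin.ext_iff]

open Polynomial Chebyshev in
/-- The correlation matrix is the Gram matrix of the Chebyshev polynomials of the second kind
on `[cos t, 1]`. -/
theorem integral_chebyshev_U_mul_U (ℓ : ℕ) (j k : Fin ℓ) {t : ℝ} (h0 : 0 ≤ t) (hπ : t ≤ Real.pi) :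
    ∫ x in Real.cos t..1, (U ℝ (j : ℕ)).eval x * (U ℝ (k : ℕ)).eval x * Real.sqrt (1 - x ^ 2) =
      Real.pi / 2 * openC t ℓ j k := by
  have hcont : Continuous fun s => openC s ℓ j k :=
    continuous_iff_continuousAt.mpr fun s => (hasDerivAt_openC ℓ j k s).continuousAt
  rw [intervalIntegral.integral_eq_sub_of_hasDerivAt_of_le
    (f := fun x => -(Real.pi / 2 * openC (Real.arccos x) ℓ j k)) (Real.cos_le_one t)
    (by have := Real.continuous_arccos; fun_prop)]
  · simp [Real.arccos_cos h0 hπ, openC_zero]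
  · intro x hx
    have hx1 : -1 < x := (Real.neg_one_le_cos t).trans_lt hx.1
    have hs : 0 < Real.sqrt (1 - x ^ 2) := Real.sqrt_pos.mpr (by nlinarith [hx.2])
    have hd := (((hasDerivAt_openC ℓ j k (Real.arccos x)).comp x
      (Real.hasDerivAt_arccos hx1.ne' hx.2.ne)).const_mul (Real.pi / 2)).neg
    refine hd.congr_deriv ?_
    have hU (n : ℕ) : Real.sin (((n : ℝ) + 1) * Real.arccos x) =
        (U ℝ n).eval x * Real.sqrt (1 - x ^ 2) := by
      have := U_real_cos (Real.arccos x) n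
      rw [Real.cos_arccos hx1.le hx.2.le, Real.sin_arccos] at this
      exact_mod_cast this.symm
    rw [hU, hU]
    field_simp
  · exact Continuous.intervalIntegrable (by fun_prop) _ _

/-- Deift–Its–Krasovsky even-symbol identity for the XX step
symbol: `det[(λ+1) I_ℓ - 2 C(ℓ)] = (2^{ℓ²}/π^ℓ) · det[∫_{-1}^1 x^{j+k} w_λ(x) dx]`,
where `w_λ(x) = √(1-x²)(λ-1)` for `cos k_F < x < 1` and `w_λ(x) = √(1-x²)(λ+1)`
for `-1 < x < cos k_F`. -/
theorem even_symbol_identity (kF : ℝ) (h0 : 0 < kF) (hπ : kF < Real.pi)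
    (lam : ℂ) (ℓ : ℕ) (hℓ : 1 ≤ ℓ) :
    Matrix.det (fun j k : Fin ℓ =>
        (lam + 1) * (if j = k then 1 else 0) - 2 * ((openC kF ℓ j k : ℝ) : ℂ))
    = (((2 : ℝ) ^ (ℓ ^ 2) / Real.pi ^ ℓ : ℝ) : ℂ) *
        Matrix.det (fun j k : Fin ℓ =>
          ∫ x in (-1 : ℝ)..1, ((x : ℂ) ^ ((j : ℕ) + (k : ℕ))) *
            (((Real.sqrt (1 - x ^ 2) : ℝ) : ℂ) *
              (if Real.cos kF < x then lam - 1 else lam + 1))) := by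
  have hw : IntervalIntegrable (fun x : ℝ => ((Real.sqrt (1 - x ^ 2) : ℝ) : ℂ) *
      (if Real.cos kF < x then lam - 1 else lam + 1)) MeasureTheory.volume (-1) 1 :=
    (intervalIntegrable_step _ _ _ _ _).continuousOn_mul (by fun_prop)
  have hdet := det_integral_polynomial_mul (fun n => Polynomial.Chebyshev.U ℝ n)
    (Polynomial.Chebyshev.natDegree_U_natCast ℝ) hw ℓ
  set G : Matrix (Fin ℓ) (Fin ℓ) ℂ := fun j k => ∫ x in (-1 : ℝ)..1,
    (((Polynomial.Chebyshev.U ℝ (j : ℕ)).eval x *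
      (Polynomial.Chebyshev.U ℝ (k : ℕ)).eval x : ℝ) : ℂ) *
      (((Real.sqrt (1 - x ^ 2) : ℝ) : ℂ) *
        (if Real.cos kF < x then lam - 1 else lam + 1)) with hG
  have hentry (j k : Fin ℓ) : (lam + 1) * (if j = k then 1 else 0) -
      2 * ((openC kF ℓ j k : ℝ) : ℂ) = (2 / Real.pi : ℂ) * G j k := by
    simp only [hG, ← mul_assoc, ← Complex.ofReal_mul]
    have h1 := integral_chebyshev_U_mul_U ℓ j k h0.le hπ.le
    have h2 := integral_chebyshev_U_mul_U ℓ j k Real.pi_pos.le le_rfl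
    rw [Real.cos_pi, openC_pi] at h2
    rw [integral_mul_step (by fun_prop) (Real.neg_one_le_cos kF) (Real.cos_le_one kF),
      intervalIntegral.integral_ofReal, intervalIntegral.integral_ofReal, h1, h2]
    have hpi : (Real.pi : ℂ) ≠ 0 := by exact_mod_cast Real.pi_ne_zero
    push_cast
    rw [apply_ite Complex.ofReal, Complex.ofReal_one, Complex.ofReal_zero]
    field_simp
    ring
  have hpow : (∏ i ∈ Finset.range ℓ,
      ((Polynomial.Chebyshev.U ℝ (i : ℕ)).leadingCoeff : ℂ)) ^ 2 * 2 ^ ℓ = 2 ^ (ℓ ^ 2) := by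
    simp only [Polynomial.Chebyshev.leadingCoeff_U_natCast, Complex.ofReal_pow,
      Complex.ofReal_ofNat]
    rw [Finset.prod_pow_eq_pow_sum, ← pow_mul, Finset.sum_range_id_mul_two, ← pow_add]
    congr 1
    obtain ⟨m, rfl⟩ := Nat.exists_eq_add_of_le hℓ
    simp only [Nat.add_sub_cancel_left]
    ring
  have hM : (fun j k => (lam + 1) * (if j = k then 1 else 0) -
      2 * ((openC kF ℓ j k : ℝ) : ℂ) : Matrix (Fin ℓ) (Fin ℓ) ℂ) = (2 / Real.pi : ℂ) • G := by
    ext j k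
    exact hentry j k
  rw [hM, Matrix.det_smul, hdet, Fintype.card_fin, Complex.ofReal_div, Complex.ofReal_pow, Complex.ofReal_pow,
    Complex.ofReal_ofNat, ← hpow]
  ring
end

section
/- For every c ∈ ℝ, lim_{b→∞} √b · ∫_{-π}^{π} e^{-b φ²} cos(c √b φ) dφ = √π · e^{-c²/4}. Equivalently, the flux integral ∫_{-π}^{π} e^{-b φ²} e^{-i m φ} dφ with m = c√b is asymptotic to √(π/b) e^{-m²/(4b)} as b → ∞. -/
open MeasureTheory in
theorem integrable_exp_neg_sq_mul_cos (c : ℝ) :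
    Integrable fun x : ℝ => Real.exp (-x ^ 2) * Real.cos (c * x) := by
  have h : Integrable fun x : ℝ => Real.exp (-x ^ 2) := by
    simpa using integrable_exp_neg_mul_sq one_pos
  refine h.mul_bdd (c := 1) (by fun_prop) (ae_of_all _ fun x => ?_)
  simpa using Real.abs_cos_le_one (c * x)

theorem integral_exp_neg_sq_mul_cos (c : ℝ) :
    ∫ x : ℝ, Real.exp (-x ^ 2) * Real.cos (c * x) =
      Real.sqrt Real.pi * Real.exp (-c ^ 2 / 4) := by
  have hre (x : ℝ) : Real.exp (-x ^ 2) * Real.cos (c * x) =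
      (Complex.exp (-1 * x ^ 2 + (c * Complex.I) * x + 0)).re := by
    simp [Complex.exp_re, ← Complex.ofReal_pow]
  have hint : MeasureTheory.Integrable
      fun x : ℝ => Complex.exp (-1 * x ^ 2 + (c * Complex.I) * x + 0) :=
    integrable_cexp_quadratic' (by simp) _ _
  simp_rw [hre]
  refine (integral_re hint).trans ?_
  rw [integral_cexp_quadratic (by simp)]
  have h : ((Real.pi : ℂ) / - -1) ^ (1 / 2 : ℂ) *
      Complex.exp (0 - (c * Complex.I) ^ 2 / (4 * -1)) =
      ((Real.sqrt Real.pi * Real.exp (-c ^ 2 / 4) : ℝ) : ℂ) := by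
    rw [Real.sqrt_eq_rpow, Complex.ofReal_mul, Complex.ofReal_cpow Real.pi_pos.le]
    push_cast
    rw [mul_pow, Complex.I_sq]
    ring_nf
  rw [h]
  exact Complex.ofReal_re _

/-- Laplace-type asymptotic underlying the Gaussian sector
projection of the charged moments: for every `c ∈ ℝ`,
`lim_{b→∞} √b ∫_{-π}^{π} e^{-bφ²} cos(c√b φ) dφ = √π e^{-c²/4}`. -/
theorem gaussian_flux_projection_asymptotics (c : ℝ) :
    Filter.Tendsto
      (fun b : ℝ =>
        Real.sqrt b *
          ∫ φ in (-Real.pi)..Real.pi,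
            Real.exp (-b * φ ^ 2) * Real.cos (c * Real.sqrt b * φ))
      Filter.atTop
      (nhds (Real.sqrt Real.pi * Real.exp (-c ^ 2 / 4))) := by
  have htop : Filter.Tendsto (fun b : ℝ => Real.sqrt b * Real.pi) Filter.atTop Filter.atTop :=
    Real.tendsto_sqrt_atTop.atTop_mul_const Real.pi_pos
  have hbot : Filter.Tendsto (fun b : ℝ => Real.sqrt b * -Real.pi) Filter.atTop Filter.atBot :=
    Real.tendsto_sqrt_atTop.atTop_mul_const_of_neg (neg_lt_zero.2 Real.pi_pos)
  rw [← integral_exp_neg_sq_mul_cos]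
  refine (MeasureTheory.intervalIntegral_tendsto_integral
    (integrable_exp_neg_sq_mul_cos c) hbot htop).congr' ?_
  filter_upwards [Filter.eventually_ge_atTop 0] with b hb
  rw [← intervalIntegral.mul_integral_comp_mul_left]
  simp_rw [mul_pow, Real.sq_sqrt hb, neg_mul, mul_assoc]
end

section
/- Let A and B be finite nonempty index types, let ψ : A × B → ℂ be a vector, let Q_A be a Hermitian A×A complex matrix and Q_B a Hermitian B×B complex matrix, and let N ∈ ℝ. Assume ψ is an eigenvector of the total charge: for all (i, j) ∈ A × B, Σ_{i'} (Q_A)_{i i'} ψ(i', j) + Σ_{j'} (Q_B)_{j j'} ψ(i, j') = N ψ(i, j). Define the reduced density matrix ρ_A on A by (ρ_A)_{i i'} = Σ_{j ∈ B} ψ(i, j) · conj(ψ(i', j)). Then ρ_A commutes with Q_A: ρ_A Q_A = Q_A ρ_A. -/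
open Matrix in
/-- If Hermitian `P` and `R` satisfy `P * M + M * R = r • M` with `r` real, then `P` commutes
with `M * Mᴴ`, because `P * (M * Mᴴ) = r • (M * Mᴴ) - M * R * Mᴴ` is Hermitian. -/
theorem Matrix.commute_mul_conjTranspose_of_mul_add_mul_eq_smul
    {m n : Type*} [Fintype m] [Fintype n] {M : Matrix m n ℂ} {P : Matrix m m ℂ}
    {R : Matrix n n ℂ} {r : ℝ} (hP : P.IsHermitian) (hR : R.IsHermitian)
    (h : P * M + M * R = (r : ℂ) • M) : Commute (M * Mᴴ) P := by
  have key : P * (M * Mᴴ) = (r : ℂ) • (M * Mᴴ) - M * R * Mᴴ := by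
    rw [← Matrix.mul_assoc, eq_sub_of_add_eq h, Matrix.sub_mul, Matrix.smul_mul]
  have herm : (P * (M * Mᴴ))ᴴ = P * (M * Mᴴ) := by
    rw [key]
    simp [conjTranspose_mul, hR.eq, Matrix.mul_assoc]
  simpa [conjTranspose_mul, hP.eq, commute_iff_eq] using herm

/-- If the global pure state `ψ` on `A × B` is an eigenvector of
the total charge `Q_A ⊗ I + I ⊗ Q_B` with eigenvalue `N`, then the reduced density
matrix `(ρ_A)_{ii'} = Σ_j ψ(i,j) conj(ψ(i',j))` commutes with the subsystem charge
`Q_A`. This is the structural fact behind the vanishing of equilibrium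
entanglement asymmetry. -/
theorem reduced_state_commutes_with_charge
    {A B : Type*} [Fintype A] [Fintype B] [Nonempty A] [Nonempty B]
    [DecidableEq A] [DecidableEq B]
    (ψ : A × B → ℂ) (QA : Matrix A A ℂ) (QB : Matrix B B ℂ) (N : ℝ)
    (hQA : QA.IsHermitian) (hQB : QB.IsHermitian)
    (hψ : ∀ (i : A) (j : B),
      (∑ i' : A, QA i i' * ψ (i', j)) + (∑ j' : B, QB j j' * ψ (i, j'))
        = (N : ℂ) * ψ (i, j))
    (ρA : Matrix A A ℂ)
    (hρ : ∀ i i' : A, ρA i i' = ∑ j : B, ψ (i, j) * star (ψ (i', j))) :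
    ρA * QA = QA * ρA := by
  let M : Matrix A B ℂ := Matrix.of fun i j => ψ (i, j)
  have hM : QA * M + M * QB.transpose = (N : ℂ) • M := by
    ext i j
    simpa [M, Matrix.mul_apply, mul_comm (ψ _)] using hψ i j
  have hρM : ρA = M * M.conjTranspose := by
    ext i i'
    simp [M, Matrix.mul_apply, hρ]
  rw [hρM]
  exact (Matrix.commute_mul_conjTranspose_of_mul_add_mul_eq_smul hQA hQB.transpose hM).eq
end
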